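/- arXiv:1510.03665 — 5 statements merged into one kernel-verified Lean document; each statement's English description precedes it below -/
import Mathlib

section
/- Let r be an odd prime and n ≥ 5. Then the alternating group A_n has a Sylow r-subgroup isomorphic to C_r × C_r (the direct product of two cyclic groups of order r) if and only if 2r ≤ n < 3r. -/
theorem val_two_iff (r n : ℕ) (hr : r.Prime) (hodd : Odd r) :
    padicValNat r n.factorial = 2 ↔ 2 * r ≤ n ∧ n < 3 * r := by
  have : Fact r.Prime := ⟨hr⟩
  have h1 : padicValNat r n.factorial = padicValNat r (n / r).factorial + n / r := by
    conv_lhs => rw [← Nat.div_add_mod n r]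
    rw [padicValNat_factorial_mul_add _ (Nat.mod_lt _ hr.pos), padicValNat_factorial_mul]
  have h3 : 3 ≤ r := by
    rcases hodd with ⟨k, hk⟩
    have := hr.two_le
    omega
  have h2 : (2 * r ≤ n ∧ n < 3 * r) ↔ n / r = 2 := by
    rw [← Nat.le_div_iff_mul_le hr.pos, ← Nat.div_lt_iff_lt_mul hr.pos]
    omega
  rw [h2, h1]
  constructor
  · intro h
    have hle : n / r ≤ 2 := by omega
    have : padicValNat r (n / r).factorial = 0 := by
      apply padicValNat.eq_zero_of_not_dvd
      rw [hr.dvd_factorial]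
      omega
    omega
  · intro h
    have : padicValNat r (n / r).factorial = 0 := by
      apply padicValNat.eq_zero_of_not_dvd
      rw [hr.dvd_factorial]
      omega
    omega

theorem val_card (r n : ℕ) (hr : r.Prime) (hodd : Odd r) (hn : 5 ≤ n) :
    (Nat.card (alternatingGroup (Fin n))).factorization r = padicValNat r n.factorial := by
  have : Fact r.Prime := ⟨hr⟩
  have : Nontrivial (Fin n) := Fin.nontrivial_iff_two_le.mpr (by omega)
  have h := two_mul_nat_card_alternatingGroup (α := Fin n)
  rw [Nat.card_perm, Nat.card_fin] at h
  rw [← h, Nat.factorization_def _ hr, padicValNat.mul (by norm_num) Nat.card_pos.ne']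
  have : padicValNat r 2 = 0 := by
    apply padicValNat.eq_zero_of_not_dvd
    intro hd
    have := (Nat.prime_dvd_prime_iff_eq hr Nat.prime_two).1 hd
    subst this
    exact absurd hodd (by decide)
  omega

theorem exists_hom (r n : ℕ) (hr : r.Prime) (hodd : Odd r) (h : 2 * r ≤ n) :
    ∃ f : Multiplicative (ZMod r × ZMod r) →* alternatingGroup (Fin n),
      Function.Injective f := by
  have : Fact r.Prime := ⟨hr⟩
  have hc : Fintype.card ((Multiplicative (ZMod r)) ⊕ (Multiplicative (ZMod r))) ≤ Fintype.card (Fin n) := by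
    have : Fintype.card (Multiplicative (ZMod r)) = r := by
      rw [Fintype.card_multiplicative, ZMod.card]
    rw [Fintype.card_sum, Fintype.card_fin, this]; omega
  obtain ⟨e⟩ := Function.Embedding.nonempty_of_card_le hc
  let t : (Multiplicative (ZMod r)) →* Equiv.Perm (Multiplicative (ZMod r)) := MulAction.toPermHom (Multiplicative (ZMod r)) (Multiplicative (ZMod r))
  have ht : Function.Injective t := MulAction.toPerm_injective
  let f : Multiplicative (ZMod r × ZMod r) →* Equiv.Perm (Fin n) :=
    (Equiv.Perm.viaEmbeddingHom e).comp ((Equiv.Perm.sumCongrHom (Multiplicative (ZMod r)) (Multiplicative (ZMod r))).comp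
      ((MonoidHom.prodMap t t).comp
        (MulEquiv.prodMultiplicative (ZMod r) (ZMod r)).toMonoidHom))
  have hf : Function.Injective f :=
    (Equiv.Perm.viaEmbeddingHom_injective e).comp
      (Equiv.Perm.sumCongrHom_injective.comp ((ht.prodMap ht).comp (MulEquiv.injective _)))
  have hs : ∀ x, f x ∈ alternatingGroup (Fin n) := by
    intro x
    rw [Equiv.Perm.mem_alternatingGroup]
    have hx : x ^ r = 1 := by
      apply Multiplicative.toAdd.injective
      rw [toAdd_pow]
      ext <;> simp
    have : (Equiv.Perm.sign (f x)) ^ r = 1 := by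
      rw [← map_pow, ← map_pow, hx, map_one, map_one]
    rcases Int.units_eq_one_or (Equiv.Perm.sign (f x)) with h | h
    · exact h
    · rw [h, hodd.neg_one_pow] at this
      exact absurd this (by decide)
  exact ⟨f.codRestrict _ hs, fun a b hab => hf (congrArg Subtype.val hab)⟩

/-- Let `r` be an odd prime and `n ≥ 5`. The alternating group `A_n` has a Sylow `r`-subgroup
isomorphic to `C_r × C_r` if and only if `2 * r ≤ n < 3 * r`. -/
theorem alternatingGroup_sylow_iso_Cr_times_Cr_iff (r n : ℕ) (hr : r.Prime) (hodd : Odd r)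
    (hn : 5 ≤ n) :
    (∃ P : Sylow r (alternatingGroup (Fin n)),
        Nonempty ((P : Subgroup (alternatingGroup (Fin n))) ≃*
          Multiplicative (ZMod r × ZMod r)))
      ↔ 2 * r ≤ n ∧ n < 3 * r := by
  have : Fact r.Prime := ⟨hr⟩
  have hcM : Nat.card (Multiplicative (ZMod r × ZMod r)) = r ^ 2 := by
    rw [Nat.card_congr Multiplicative.toAdd, Nat.card_prod, Nat.card_zmod, sq]
  have hv := val_card r n hr hodd hn
  constructor
  · rintro ⟨P, ⟨φ⟩⟩
    have h1 := P.card_eq_multiplicity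
    rw [hv, Nat.card_congr φ.toEquiv, hcM] at h1
    exact (val_two_iff r n hr hodd).1 (Nat.pow_right_injective hr.two_le h1).symm
  · intro h
    obtain ⟨f, hf⟩ := exists_hom r n hr hodd h.1
    have e := MonoidHom.ofInjective hf
    refine ⟨Sylow.ofCard f.range ?_, ⟨e.symm⟩⟩
    rw [hv, (val_two_iff r n hr hodd).2 h, ← hcM, Nat.card_congr e.toEquiv]
end

section
/- Let r be an odd prime and n a natural number with n < r^2. Then every Sylow r-subgroup of the alternating group A_n is isomorphic to the elementary abelian group C_r^{⌊n/r⌋}, the direct product of ⌊n/r⌋ copies of the cyclic group of order r. -/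
/-- The block translation action. -/
def blockHom (r k : ℕ) : (Fin k → Multiplicative (ZMod r)) →* Equiv.Perm (Fin k × ZMod r) where
  toFun f :=
    { toFun := fun p => (p.1, Multiplicative.toAdd (f p.1) + p.2)
      invFun := fun p => (p.1, - Multiplicative.toAdd (f p.1) + p.2)
      left_inv := fun p => by simp
      right_inv := fun p => by simp }
  map_one' := by ext p <;> simp
  map_mul' f g := by ext p <;> simp [add_assoc]

theorem blockHom_injective (r k : ℕ) : Function.Injective (blockHom r k) := by
  intro f g h
  funext i
  have := congrArg (fun e : Equiv.Perm (Fin k × ZMod r) => (e (i, 0)).2) h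
  simpa [blockHom] using this

theorem card_fact (r n : ℕ) (hr : r.Prime) (hodd : Odd r) (hn : n < r ^ 2) :
    (Nat.card (alternatingGroup (Fin n))).factorization r = n / r := by
  have h3 : 3 ≤ r := by
    have := hr.two_le
    rcases hodd with ⟨m, hm⟩
    omega
  have hf : (n.factorial).factorization r = n / r := by
    have hlog : Nat.log r n < 2 := Nat.log_lt_of_lt_pow' (by norm_num) hn
    rw [Nat.factorization_factorial hr hlog]
    simp
  rcases Nat.lt_or_ge n 2 with h | h
  · have : Subsingleton (Fin n) := by
      rw [Fin.subsingleton_iff_le_one]; omega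
    have h1 : Nat.card (alternatingGroup (Fin n)) = 1 := Nat.card_of_subsingleton 1
    rw [h1, Nat.div_eq_of_lt (by omega)]
    simp
  · haveI : Nontrivial (Fin n) := Fin.nontrivial_iff_two_le.2 h
    have h2 := two_mul_nat_card_alternatingGroup (α := Fin n)
    rw [Nat.card_perm, Nat.card_fin] at h2
    rw [← hf, ← h2, Nat.factorization_mul (by norm_num) Nat.card_pos.ne']
    have : Nat.factorization 2 r = 0 := Nat.factorization_eq_zero_of_lt (by omega)
    simp [this]

/-- Let `r` be an odd prime and `n < r ^ 2`. Every Sylow `r`-subgroup of the alternating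
group `A_n` is isomorphic to the elementary abelian group `C_r ^ ⌊n / r⌋`. -/
theorem alternatingGroup_sylow_iso_elementaryAbelian (r n : ℕ) (hr : r.Prime) (hodd : Odd r)
    (hn : n < r ^ 2) (P : Sylow r (alternatingGroup (Fin n))) :
    Nonempty ((P : Subgroup (alternatingGroup (Fin n))) ≃*
      (Fin (n / r) → Multiplicative (ZMod r))) := by
  haveI : Fact r.Prime := ⟨hr⟩
  haveI : NeZero r := ⟨hr.ne_zero⟩
  obtain ⟨ι⟩ : Nonempty (Fin (n / r) × ZMod r ↪ Fin n) := by
    apply Function.Embedding.nonempty_of_card_le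
    simpa [ZMod.card] using Nat.div_mul_le_self n r
  let φ : (Fin (n / r) → Multiplicative (ZMod r)) →* Equiv.Perm (Fin n) :=
    (Equiv.Perm.viaEmbeddingHom ι).comp (blockHom r (n / r))
  have hφ : Function.Injective φ :=
    (Equiv.Perm.viaEmbeddingHom_injective ι).comp (blockHom_injective r _)
  have hmem : ∀ f, φ f ∈ alternatingGroup (Fin n) := by
    intro f
    rw [Equiv.Perm.mem_alternatingGroup]
    have hf : f ^ r = 1 := by
      funext i
      apply Multiplicative.toAdd.injective
      simp
    have h1 : (Equiv.Perm.sign (φ f)) ^ r = 1 := by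
      rw [← map_pow, ← map_pow, hf, map_one, map_one]
    rcases Int.units_eq_one_or (Equiv.Perm.sign (φ f)) with h | h
    · exact h
    · rw [h, hodd.neg_one_pow] at h1
      exact absurd h1 (by decide)
  let ψ := φ.codRestrict (alternatingGroup (Fin n)) hmem
  have hψ : Function.Injective ψ := fun a b h => hφ (congrArg Subtype.val h)
  let e := MonoidHom.ofInjective hψ
  have hc : Nat.card ψ.range = r ^ (Nat.card (alternatingGroup (Fin n))).factorization r := by
    rw [card_fact r n hr hodd hn, ← Nat.card_congr e.toEquiv]
    simp
  let Q : Sylow r (alternatingGroup (Fin n)) := Sylow.ofCard ψ.range hc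
  exact ⟨(Sylow.equiv P Q).trans e.symm⟩
end

section
/- Let q ≥ 2 be a natural number, r an odd prime not dividing q, and let m be the multiplicative order of q modulo r (so that r is a primitive prime divisor of q^m − 1). Then for every natural number n ≥ 1, r divides Φ_n(q) if and only if n = m·r^j for some j ≥ 0. -/
/-- Let `q ≥ 2`, let `r` be an odd prime not dividing `q`, and let `m` be the multiplicative
order of `q` modulo `r`. Then for every `n ≥ 1`, `r ∣ Φ_n(q)` if and only if `n = m * r ^ j`
for some `j ≥ 0`. -/
theorem prime_dvd_cyclotomic_iff (q r : ℕ) (hq : 2 ≤ q) (hr : r.Prime) (hodd : Odd r)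
    (hnd : ¬ r ∣ q) (m : ℕ) (hm : m = orderOf (q : ZMod r)) (n : ℕ) (hn : 1 ≤ n) :
    (r : ℤ) ∣ (Polynomial.cyclotomic n ℤ).eval (q : ℤ) ↔ ∃ j : ℕ, n = m * r ^ j := by
  have : Fact r.Prime := ⟨hr⟩
  have hq0 : (q : ZMod r) ≠ 0 := by
    rwa [Ne, ZMod.natCast_eq_zero_iff]
  have hdvd : m ∣ r - 1 := by
    rw [hm]
    exact orderOf_dvd_of_pow_eq_one (ZMod.pow_card_sub_one_eq_one hq0)
  have hr1 : 0 < r - 1 := Nat.sub_pos_of_lt hr.one_lt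
  have hrm : ¬ r ∣ m := by
    intro h
    have := Nat.le_of_dvd hr1 (h.trans hdvd)
    omega
  have key : (r : ℤ) ∣ (Polynomial.cyclotomic n ℤ).eval (q : ℤ) ↔
      (Polynomial.cyclotomic n (ZMod r)).IsRoot (q : ZMod r) := by
    rw [← ZMod.intCast_zmod_eq_zero_iff_dvd, Polynomial.IsRoot.def,
      ← Polynomial.map_cyclotomic_int n (ZMod r)]
    have h := Polynomial.eval_intCast_map (Int.castRingHom (ZMod r))
      (Polynomial.cyclotomic n ℤ) (q : ℤ)
    rw [Int.cast_natCast] at h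
    rw [h]
    simp
  rw [key]
  constructor
  · intro h
    obtain ⟨k, n', hn', rfl⟩ := Nat.exists_eq_pow_mul_and_not_dvd (n := n) (by omega) r hr.ne_one
    have : NeZero (n' : ZMod r) := ⟨by rwa [Ne, ZMod.natCast_eq_zero_iff]⟩
    rw [Polynomial.isRoot_cyclotomic_prime_pow_mul_iff_of_charP] at h
    exact ⟨k, by rw [hm, ← h.eq_orderOf, mul_comm]⟩
  · rintro ⟨j, rfl⟩
    have : NeZero (m : ZMod r) := ⟨by rwa [Ne, ZMod.natCast_eq_zero_iff]⟩
    rw [mul_comm, Polynomial.isRoot_cyclotomic_prime_pow_mul_iff_of_charP, hm]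
    exact IsPrimitiveRoot.orderOf _
end

section
/- Let F be a finite field of cardinality q and let r be an odd prime not dividing q. Then every Sylow r-subgroup of the projective special linear group PSL_2(F) is cyclic. -/
open Matrix

lemma aux_pow {R : Type*} [CommRing R] (s : Matrix (Fin 2) (Fin 2) R)
    (h : (s - 1) * (s - 1) = 0) (n : ℕ) : s ^ n = 1 + (n : R) • (s - 1) := by
  induction n with
  | zero => simp
  | succ k ih =>
    have h2 : (s - 1) * s = s - 1 := by
      have : (s - 1) * s = (s - 1) * (s - 1) + (s - 1) := by noncomm_ring
      rw [this, h, zero_add]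
    rw [pow_succ, ih, add_mul, smul_mul_assoc, h2]
    push_cast
    rw [add_smul, one_smul, one_mul]
    abel

lemma aux_comm {F : Type*} [Field F] (z s : Matrix (Fin 2) (Fin 2) F)
    (hz : ¬ (z 0 1 = 0 ∧ z 1 0 = 0 ∧ z 0 0 = z 1 1)) (h : s * z = z * s) :
    ∃ x y : F, s = x • (1 : Matrix (Fin 2) (Fin 2) F) + y • z := by
  have h00 := congrFun (congrFun h 0) 0
  have h01 := congrFun (congrFun h 0) 1
  have h10 := congrFun (congrFun h 1) 0
  simp only [Matrix.mul_apply, Fin.sum_univ_two] at h00 h01 h10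
  by_cases hb : z 0 1 = 0
  · by_cases hc : z 1 0 = 0
    · have hd : z 0 0 - z 1 1 ≠ 0 := fun hh => hz ⟨hb, hc, sub_eq_zero.mp hh⟩
      have hf : s 0 1 = 0 := by
        apply (mul_eq_zero.mp (?_ : s 0 1 * (z 0 0 - z 1 1) = 0)).resolve_right hd
        rw [hb] at h01; linear_combination -h01
      have hg : s 1 0 = 0 := by
        apply (mul_eq_zero.mp (?_ : s 1 0 * (z 0 0 - z 1 1) = 0)).resolve_right hd
        rw [hc] at h10; linear_combination h10
      refine ⟨s 0 0 - (s 0 0 - s 1 1) / (z 0 0 - z 1 1) * z 0 0,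
        (s 0 0 - s 1 1) / (z 0 0 - z 1 1), ?_⟩
      ext i j
      fin_cases i <;> fin_cases j <;> simp [hb, hc, hf, hg]
      field_simp
      ring
    · refine ⟨s 0 0 - s 1 0 / z 1 0 * z 0 0, s 1 0 / z 1 0, ?_⟩
      ext i j
      fin_cases i <;> fin_cases j <;> simp [hc] <;> field_simp <;>
        first | linear_combination h00 | linear_combination -h00 | linear_combination h10 | linear_combination -h10
  · refine ⟨s 0 0 - s 0 1 / z 0 1 * z 0 0, s 0 1 / z 0 1, ?_⟩
    ext i j
    fin_cases i <;> fin_cases j <;> simp [hb] <;> field_simp <;>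
        first | linear_combination h00 | linear_combination -h00 | linear_combination h01 | linear_combination -h01

lemma aux_unip {F : Type*} [Field F] (s : Matrix (Fin 2) (Fin 2) F) (hd : s.det = 1)
    (h1 : (s - 1).det = 0) (n : ℕ) (hn : (n : F) ≠ 0) (hp : s ^ n = 1) : s = 1 := by
  have hsq : (s - 1) * (s - 1) = 0 := by
    rw [Matrix.det_fin_two] at hd h1
    simp at h1
    ext i j
    fin_cases i <;> fin_cases j <;> simp [Matrix.mul_apply, Fin.sum_univ_two]
    · linear_combination (1 - s 0 0) * (h1 - hd) - hd + (h1 - hd) * 0 + (hd - h1) * 0 - (h1 - hd) + h1 - h1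
    · linear_combination (- s 0 1) * (h1 - hd)
    · linear_combination (- s 1 0) * (h1 - hd)
    · linear_combination (1 - s 1 1) * (h1 - hd) - hd - (h1 - hd)
  have := aux_pow s hsq n
  rw [hp] at this
  have h3 : (n : F) • (s - 1) = 0 := by simpa using this.symm
  exact sub_eq_zero.mp ((smul_eq_zero.mp h3).resolve_left hn)

lemma aux_cyclic {F : Type*} [Field F] [Fintype F] (r : ℕ) (hr : r.Prime) (hodd : Odd r)
    (hrF : (r : F) ≠ 0) (S : Subgroup (SpecialLinearGroup (Fin 2) F)) (hS : IsPGroup r S) :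
    IsCyclic S := by
  classical
  have := Fact.mk hr
  rcases subsingleton_or_nontrivial S with hs | hs
  · infer_instance
  have := hS.center_nontrivial
  obtain ⟨z, hz⟩ := exists_ne (1 : Subgroup.center S)
  let Z : Matrix (Fin 2) (Fin 2) F := ((z : S) : SpecialLinearGroup (Fin 2) F)
  have hZdet : Z.det = 1 := ((z : S) : SpecialLinearGroup (Fin 2) F).2
  have hcom : ∀ s : S, ((s : SpecialLinearGroup (Fin 2) F) : Matrix (Fin 2) (Fin 2) F) * Z
      = Z * ((s : SpecialLinearGroup (Fin 2) F) : Matrix (Fin 2) (Fin 2) F) := by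
    intro s
    have := Subgroup.mem_center_iff.mp z.2 s
    have := congrArg (fun t : S => ((t : SpecialLinearGroup (Fin 2) F) : Matrix (Fin 2) (Fin 2) F)) this
    simpa using this
  have hns : ¬ (Z 0 1 = 0 ∧ Z 1 0 = 0 ∧ Z 0 0 = Z 1 1) := by
    rintro ⟨hb, hc, had⟩
    apply hz
    have hsq : Z ^ 2 = 1 := by
      rw [Matrix.det_fin_two, hb, had] at hZdet
      ext i j
      fin_cases i <;> fin_cases j <;>
        simp [pow_two, Matrix.mul_apply, Fin.sum_univ_two, hb, hc, had] <;>
        linear_combination hZdet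
    have hz2 : (z : S) ^ 2 = 1 := by
      apply Subtype.ext; apply Subtype.ext
      simpa using hsq
    obtain ⟨k, hk⟩ := hS (z : S)
    have h1 := orderOf_dvd_of_pow_eq_one hz2
    have h2 := orderOf_dvd_of_pow_eq_one hk
    have hco : Nat.Coprime 2 (r ^ k) := (Nat.coprime_two_left.mpr (hodd.pow))
    have := Nat.eq_one_of_dvd_coprimes hco h1 h2
    exact Subtype.ext (orderOf_eq_one_iff.mp this)
  let K := AlgebraicClosure F
  let φ := algebraMap F K
  obtain ⟨l, hl⟩ : ∃ l : K, Module.End.HasEigenvalue (Matrix.toLin' (Z.map φ)) l :=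
    Module.End.exists_eigenvalue _
  obtain ⟨v, hv⟩ := hl.exists_hasEigenvector
  have hv0 : v ≠ 0 := hv.2
  have hvl : (Z.map φ) *ᵥ v = l • v := by
    rw [← Matrix.toLin'_apply]; exact hv.apply_eq_smul
  let M : S → Matrix (Fin 2) (Fin 2) K := fun s =>
    ((s : SpecialLinearGroup (Fin 2) F) : Matrix (Fin 2) (Fin 2) F).map φ
  have hM1 : M 1 = 1 := by simp [M]
  have hMm : ∀ s t, M (s * t) = M s * M t := by
    intro s t; simp [M, Matrix.map_mul]
  have hex : ∀ s : S, ∃ c : K, M s *ᵥ v = c • v := by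
    intro s
    obtain ⟨x, y, hxy⟩ := aux_comm Z _ hns (hcom s)
    refine ⟨φ x + φ y * l, ?_⟩
    have : M s = φ x • (1 : Matrix (Fin 2) (Fin 2) K) + φ y • Z.map φ := by
      simp only [M]
      rw [hxy]
      ext i j
      fin_cases i <;> fin_cases j <;> simp
    rw [this, Matrix.add_mulVec, Matrix.smul_mulVec, Matrix.smul_mulVec, hvl, Matrix.one_mulVec,
      add_smul, mul_smul]
  choose χ hχ using hex
  have huniq : ∀ a b : K, a • v = b • v → a = b := fun a b h => smul_left_injective K hv0 h
  let f : S →* K :=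
    { toFun := χ
      map_one' := by
        apply huniq; rw [← hχ, hM1]; simp
      map_mul' := by
        intro s t
        apply huniq
        rw [← hχ, hMm, ← Matrix.mulVec_mulVec, hχ t, Matrix.mulVec_smul, hχ s, smul_smul, mul_comm] }
  have hker : ∀ s : S, χ s = 1 → s = 1 := by
    intro s hs1
    have h1 : M s *ᵥ v = v := by rw [hχ, hs1, one_smul]
    have h2 : (M s - 1).det = 0 := by
      apply Matrix.exists_mulVec_eq_zero_iff.mp
      exact ⟨v, hv0, by rw [Matrix.sub_mulVec, h1, Matrix.one_mulVec, sub_self]⟩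
    have h3 : (((s : SpecialLinearGroup (Fin 2) F) : Matrix (Fin 2) (Fin 2) F) - 1).det = 0 := by
      apply φ.injective
      rw [map_zero, ← h2, RingHom.map_det]
      congr 1
      ext i j
      fin_cases i <;> fin_cases j <;> simp [M]
    obtain ⟨k, hk⟩ := hS s
    apply Subtype.ext; apply Subtype.ext
    have := aux_unip _ (s : SpecialLinearGroup (Fin 2) F).2 h3 (r ^ k)
      (by push_cast; exact pow_ne_zero _ hrF)
      (by
        have := congrArg (fun t : S => ((t : SpecialLinearGroup (Fin 2) F) : Matrix (Fin 2) (Fin 2) F)) hk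
        simpa using this)
    simpa using this
  have hinj : Function.Injective f := by
    intro s t hst
    have : f (s * t⁻¹) = 1 := by
      rw [map_mul, hst, ← map_mul, mul_inv_cancel, map_one]
    exact mul_inv_eq_one.mp (hker _ this)
  exact isCyclic_of_injective_ringHom f hinj

/-- Let `F` be a finite field of cardinality `q` and `r` an odd prime not dividing `q`.
Every Sylow `r`-subgroup of `PSL₂(F)` is cyclic. -/
theorem psl_two_sylow_isCyclic (F : Type*) [Field F] [Fintype F] (q r : ℕ)
    (hq : Fintype.card F = q) (hr : r.Prime) (hodd : Odd r) (hnd : ¬ r ∣ q)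
    (P : Sylow r (ProjectiveSpecialLinearGroup (Fin 2) F)) :
    IsCyclic (P : Subgroup (ProjectiveSpecialLinearGroup (Fin 2) F)) := by
  classical
  have := Fact.mk hr
  have hrF : (r : F) ≠ 0 := by
    intro h0
    have hco : Nat.Coprime r q := (Nat.Prime.coprime_iff_not_dvd hr).mpr hnd
    have hq0 : (q : F) = 0 := by rw [← hq]; exact FiniteField.cast_card_eq_zero F
    have hI : IsCoprime (r : ℤ) (q : ℤ) := Nat.isCoprime_iff_coprime.mpr hco
    obtain ⟨a, b, hab⟩ := hI
    have := congrArg (Int.cast : ℤ → F) hab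
    push_cast at this
    rw [h0, hq0] at this
    simp at this
  let S : Sylow r (SpecialLinearGroup (Fin 2) F) := default
  let π : SpecialLinearGroup (Fin 2) F →* ProjectiveSpecialLinearGroup (Fin 2) F :=
    QuotientGroup.mk' _
  have hπ : Function.Surjective π := QuotientGroup.mk'_surjective _
  have : Finite (ProjectiveSpecialLinearGroup (Fin 2) F) := Finite.of_surjective π hπ
  have := aux_cyclic r hr hodd hrF (S : Subgroup _) S.isPGroup'
  let T := S.mapSurjective hπ
  have hT : IsCyclic ((S : Subgroup (SpecialLinearGroup (Fin 2) F)).map π) :=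
    isCyclic_of_surjective _ (π.subgroupMap_surjective (S : Subgroup _))
  have hT' : IsCyclic (T : Subgroup (ProjectiveSpecialLinearGroup (Fin 2) F)) := hT
  exact isCyclic_of_surjective _ (Sylow.equiv T P).surjective
end

section
/- Let F be a finite field of cardinality q, let r be an odd prime not dividing q, let m ≥ 2 be the multiplicative order of q modulo r, and let t be the natural number with r^t exactly dividing q^m − 1. If n ≥ 2 and n < m·r, then every Sylow r-subgroup of the projective special linear group PSL_n(F) is isomorphic to the direct product of ⌊n/m⌋ copies of the cyclic group C_{r^t} of order r^t. -/
open Matrix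

lemma aux_val (q r m t : ℕ) (hr : r.Prime) (hodd : Odd r) (hnd : ¬ r ∣ q) (hq1 : 1 < q)
    (hm : m = orderOf (q : ZMod r)) (hm2 : 2 ≤ m)
    (ht : padicValNat r (q ^ m - 1) = t) (j : ℕ) (hj : 0 < j) (hjm : j < m * r) :
    padicValNat r (q ^ j - 1) = if m ∣ j then t else 0 := by
  have : Fact r.Prime := ⟨hr⟩
  have key : ∀ j, r ∣ q ^ j - 1 ↔ m ∣ j := by
    intro j
    rw [hm, orderOf_dvd_iff_pow_eq_one, ← ZMod.natCast_eq_zero_iff,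
      Nat.cast_sub (Nat.one_le_pow _ _ (by omega)), sub_eq_zero]
    simp
  split_ifs with h
  · obtain ⟨i, rfl⟩ := h
    have hi : i < r := lt_of_mul_lt_mul_left hjm (Nat.zero_le _)
    have hi0 : i ≠ 0 := by rintro rfl; simp at hj
    have h1 := padicValNat.pow_sub_pow (p := r) hodd (x := q ^ m) (y := 1)
      (Nat.one_lt_pow (by omega) hq1) ((key m).2 dvd_rfl)
      (fun h => hnd (hr.dvd_of_dvd_pow h)) hi0
    rw [one_pow, ← pow_mul, ht,
      padicValNat.eq_zero_of_not_dvd (Nat.not_dvd_of_pos_of_lt (by omega) hi)] at h1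
    simpa using h1
  · exact padicValNat.eq_zero_of_not_dvd (fun h' => h ((key j).1 h'))

lemma aux_card (F : Type*) [Field F] [Fintype F] (q r m t n : ℕ)
    (hq : Fintype.card F = q) (hr : r.Prime) (hodd : Odd r) (hnd : ¬ r ∣ q) (hq1 : 1 < q)
    (hm : m = orderOf (q : ZMod r)) (hm2 : 2 ≤ m)
    (ht : padicValNat r (q ^ m - 1) = t) (hnm : n < m * r) :
    padicValNat r (Nat.card (GL (Fin n) F)) = n / m * t := by
  have : Fact r.Prime := ⟨hr⟩
  have h1 : ∀ i ∈ Finset.range n, q ^ n - q ^ i = q ^ i * (q ^ (n - i) - 1) := by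
    intro i hi
    have := Finset.mem_range.1 hi
    rw [Nat.mul_sub, ← pow_add, mul_one, Nat.add_sub_cancel' this.le]
  have hpos : ∀ j, 0 < j → q ^ j - 1 ≠ 0 := fun j hj => by
    have := Nat.one_lt_pow hj.ne' hq1
    omega
  rw [card_GL_field, hq, Fin.prod_univ_eq_prod_range (fun i => q ^ n - q ^ i) n,
    Finset.prod_congr rfl h1, ← Nat.factorization_def _ hr, Nat.factorization_prod]
  · simp only [Finsupp.finsetSum_apply]
    have h2 : ∀ i ∈ Finset.range n, (q ^ i * (q ^ (n - i) - 1)).factorization r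
        = (fun j => if m ∣ j + 1 then t else 0) (n - 1 - i) := by
      intro i hi
      have := Finset.mem_range.1 hi
      rw [Nat.factorization_def _ hr, padicValNat.mul (pow_ne_zero _ (by omega)) (hpos _ (by omega)),
        aux_val q r m t hr hodd hnd hq1 hm hm2 ht _ (by omega) (by omega),
        padicValNat.eq_zero_of_not_dvd (fun h => hnd (hr.dvd_of_dvd_pow h)), zero_add]
      have : n - 1 - i + 1 = n - i := by omega
      simp only [this]
    rw [Finset.sum_congr rfl h2, Finset.sum_range_reflect (fun j => if m ∣ j + 1 then t else 0) n,
      ← Finset.sum_filter, Finset.sum_const, Nat.card_multiples, smul_eq_mul]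
  · intro i hi
    have := Finset.mem_range.1 hi
    exact mul_ne_zero (pow_ne_zero _ (by omega)) (hpos _ (by omega))

lemma aux_cyc (G : Type*) [Group G] [Finite G] [IsCyclic G] (d : ℕ) (hd : d ∣ Nat.card G) :
    ∃ f : Multiplicative (ZMod d) →* G, Function.Injective f := by
  obtain ⟨g, hg⟩ := IsCyclic.exists_ofOrder_eq_natCard (α := G)
  have ho : orderOf (g ^ (orderOf g / d)) = d :=
    orderOf_pow_orderOf_div (hg ▸ Nat.card_pos.ne') (hg ▸ hd)
  have hc : Nat.card (Multiplicative (ZMod d)) =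
      Nat.card (Subgroup.zpowers (g ^ (orderOf g / d))) := by
    rw [Nat.card_zpowers, ho]
    exact Nat.card_zmod d
  let e := mulEquivOfCyclicCardEq hc
  exact ⟨(Subgroup.subtype _).comp e.toMonoidHom, Subtype.val_injective.comp e.injective⟩

lemma aux_emb (F : Type*) [Field F] [Fintype F] (m n d : ℕ) (hm : 0 < m)
    (hd : d ∣ Fintype.card F ^ m - 1) :
    ∃ f : (Fin (n / m) → Multiplicative (ZMod d)) →* Matrix (Fin n) (Fin n) F,
      Function.Injective f := by
  obtain ⟨p, hp⟩ := CharP.exists F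
  have : Fact p.Prime := ⟨CharP.char_is_prime F p⟩
  have : NeZero m := ⟨hm.ne'⟩
  let K := FiniteField.Extension F p m
  have hK : Nat.card Kˣ = Fintype.card F ^ m - 1 := by
    rw [Nat.card_units, FiniteField.natCard_extension, Nat.card_eq_fintype_card]
  obtain ⟨z, hz⟩ := aux_cyc Kˣ d (hK ▸ hd)
  let A := (Fin (n / m) → K) × (Fin (n % m) → F)
  have hA : Module.finrank F A = n := by
    have h := FiniteField.finrank_extension F p m
    rw [Module.finrank_prod, Module.finrank_pi_fintype, Module.finrank_fin_fun]
    simp only [K, h, Finset.sum_const, Finset.card_univ, Fintype.card_fin, smul_eq_mul]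
    exact Nat.div_add_mod' n m
  let b : Module.Basis (Fin n) F A := Module.finBasisOfFinrankEq F A hA
  let g : (Fin (n / m) → Multiplicative (ZMod d)) →* A :=
    { toFun := fun a => (fun i => (z (a i) : K), 1)
      map_one' := by ext <;> simp
      map_mul' := fun x y => Prod.ext (by funext i; simp; rfl) (by funext i; exact (one_mul _).symm) }
  refine ⟨((Algebra.leftMulMatrix b : A →ₐ[F] _) : A →* _).comp g, ?_⟩
  refine (Algebra.leftMulMatrix_injective b).comp ?_
  intro x y hxy
  funext i
  exact hz (Units.ext (congrFun (congrArg Prod.fst hxy) i))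

theorem psl_sylow_iso_homocyclic (F : Type*) [Field F] [Fintype F] (q r m t n : ℕ)
    (hq : Fintype.card F = q) (hr : r.Prime) (hodd : Odd r) (hnd : ¬ r ∣ q)
    (hm : m = orderOf (q : ZMod r)) (hm2 : 2 ≤ m)
    (ht : (r : ℤ) ^ t ∣ (q : ℤ) ^ m - 1 ∧ ¬ ((r : ℤ) ^ (t + 1) ∣ (q : ℤ) ^ m - 1))
    (hn : 2 ≤ n) (hnm : n < m * r)
    (P : Sylow r (ProjectiveSpecialLinearGroup (Fin n) F)) :
    Nonempty ((P : Subgroup (ProjectiveSpecialLinearGroup (Fin n) F)) ≃*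
      (Fin (n / m) → Multiplicative (ZMod (r ^ t)))) := by
  have : Fact r.Prime := ⟨hr⟩
  have : NeZero (r ^ t) := ⟨pow_ne_zero _ hr.ne_zero⟩
  have hq1 : 1 < q := hq ▸ Fintype.one_lt_card
  have hcast : ((q ^ m - 1 : ℕ) : ℤ) = (q : ℤ) ^ m - 1 := by
    rw [Nat.cast_sub (Nat.one_le_pow _ _ (by omega))]; simp
  rw [← hcast] at ht
  have ht1 : r ^ t ∣ q ^ m - 1 := by exact_mod_cast ht.1
  have ht2 : ¬ r ^ (t + 1) ∣ q ^ m - 1 := by exact_mod_cast ht.2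
  have hne : q ^ m - 1 ≠ 0 := by
    have := Nat.one_lt_pow (show m ≠ 0 by omega) hq1
    omega
  have htv : padicValNat r (q ^ m - 1) = t := by
    rw [padicValNat_dvd_iff_le hne] at ht1 ht2
    omega
  have hcop : Nat.Coprime (r ^ t) (q - 1) := by
    refine Nat.Coprime.pow_left _ ((Nat.Prime.coprime_iff_not_dvd hr).2 ?_)
    intro h
    rw [← ZMod.natCast_eq_zero_iff, Nat.cast_sub hq1.le, sub_eq_zero] at h
    rw [h, Nat.cast_one, orderOf_one] at hm
    omega
  obtain ⟨f, hf⟩ := aux_emb F m n (r ^ t) (by omega) (hq ▸ ht1)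
  have hpow : ∀ a : Fin (n / m) → Multiplicative (ZMod (r ^ t)), a ^ (r ^ t) = 1 := by
    intro a
    funext i
    have h : Nat.card (Multiplicative (ZMod (r ^ t))) = r ^ t := Nat.card_zmod _
    have := pow_card_eq_one' (x := a i)
    rwa [h] at this
  have hunit : ∀ c : F, c ^ (r ^ t) = 1 → c = 1 := by
    intro c hc
    have hc0 : c ≠ 0 := by
      rintro rfl
      rw [zero_pow (NeZero.ne _)] at hc
      exact zero_ne_one hc
    have h2 := FiniteField.pow_card_sub_one_eq_one c hc0
    rw [hq] at h2
    have := pow_gcd_eq_one.2 ⟨hc, h2⟩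
    rwa [hcop, pow_one] at this
  have hdet : ∀ a, (f a).det = 1 := fun a => hunit _ (by
    rw [← det_pow, ← map_pow, hpow, map_one, det_one])
  let g : (Fin (n / m) → Multiplicative (ZMod (r ^ t))) →* SpecialLinearGroup (Fin n) F :=
    { toFun := fun a => ⟨f a, hdet a⟩
      map_one' := by ext : 1; simp
      map_mul' := fun x y => Subtype.ext (map_mul f x y) }
  let h : (Fin (n / m) → Multiplicative (ZMod (r ^ t))) →*
      ProjectiveSpecialLinearGroup (Fin n) F := (QuotientGroup.mk' _).comp g
  have hinj : Function.Injective h := by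
    rw [injective_iff_map_eq_one]
    intro a ha
    have ha' : g a ∈ Subgroup.center (SpecialLinearGroup (Fin n) F) :=
      (QuotientGroup.eq_one_iff _).1 ha
    obtain ⟨c, -, hc⟩ := Matrix.SpecialLinearGroup.mem_center_iff.1 ha'
    have hc' : scalar (Fin n) c = f a := hc
    have : Nonempty (Fin n) := ⟨⟨0, by omega⟩⟩
    have : c ^ (r ^ t) = 1 := by
      apply Matrix.scalar_inj (n := Fin n) |>.1
      rw [map_pow, hc', ← map_pow, hpow, map_one, map_one]
    rw [hunit c this, map_one] at hc'
    exact hf (by rw [← hc', map_one])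
  have hcA : Nat.card h.range = r ^ (n / m * t) := by
    rw [← Nat.card_congr (MonoidHom.ofInjective hinj).toEquiv, Nat.card_fun]
    have h : Nat.card (Multiplicative (ZMod (r ^ t))) = r ^ t := Nat.card_zmod _
    rw [h, Nat.card_fin, ← pow_mul, mul_comm]
  have : Finite (SpecialLinearGroup (Fin n) F) := inferInstance
  have : Finite (ProjectiveSpecialLinearGroup (Fin n) F) :=
    Finite.of_surjective _ (QuotientGroup.mk'_surjective (Subgroup.center _))
  have hdvd : Nat.card (ProjectiveSpecialLinearGroup (Fin n) F) ∣ Nat.card (GL (Fin n) F) :=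
    (Subgroup.card_quotient_dvd_card _).trans
      (Subgroup.card_dvd_of_injective SpecialLinearGroup.toGL SpecialLinearGroup.toGL_injective)
  have hle : (Nat.card (ProjectiveSpecialLinearGroup (Fin n) F)).factorization r ≤ n / m * t := by
    rw [← aux_card F q r m t n hq hr hodd hnd hq1 hm hm2 htv hnm, ← Nat.factorization_def _ hr]
    exact (Nat.factorization_le_iff_dvd Nat.card_pos.ne' Nat.card_pos.ne').2 hdvd r
  have hge : n / m * t ≤ (Nat.card (ProjectiveSpecialLinearGroup (Fin n) F)).factorization r := by
    rw [← hr.pow_dvd_iff_le_factorization Nat.card_pos.ne', ← hcA]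
    exact Subgroup.card_subgroup_dvd_card _
  let Q : Sylow r (ProjectiveSpecialLinearGroup (Fin n) F) :=
    Sylow.ofCard h.range (by rw [hcA, le_antisymm hle hge])
  have e1 : P ≃* Q := Sylow.equiv P Q
  have e2 : (Q : Subgroup (ProjectiveSpecialLinearGroup (Fin n) F)) ≃* h.range :=
    MulEquiv.subgroupCongr rfl
  exact ⟨(e1.trans e2).trans (MonoidHom.ofInjective hinj).symm⟩
end
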